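/- Fix R_min > 0. There exists ε₀ > 0, depending only on R_min, such that the following holds for every ε with 0 < ε < min(ε₀, (2/9) R_min). Let M ⊆ ℝ^D be a nonempty compact set and let R_w, R_L be real numbers with R_min ≤ R_w, R_L − R_w > (9/4) ε, the reach of M equal to R_w, h_M(R_w) = R_w, h_M(t) < t for all t ∈ (0, R_w), and h_M(t) ≤ R_L − √(R_L² − t²) for all t ∈ [0, R_w). Let M̃ ⊆ ℝ^D be a nonempty compact set with Hausdorff distance H(M, M̃) < ε. Then r := inf { t ≥ (22/4) ε : h_{M̃}(t) ≥ t − 3ε } satisfies |R_w − r| ≤ ε. -/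

import Mathlib

/-- The radius of a smallest enclosing closed ball of `σ`. -/
noncomputable def rad {E : Type*} [NormedAddCommGroup E] (σ : Set E) : ℝ :=
  sInf {r : ℝ | 0 ≤ r ∧ ∃ c : E, σ ⊆ Metric.closedBall c r}

/-- Asymmetric Hausdorff distance `H(A | B) = sup_{a ∈ A} dist (a, B)`. -/
noncomputable def asymmHaus {E : Type*} [NormedAddCommGroup E] (A B : Set E) : ℝ :=
  sSup ((fun a => Metric.infDist a B) '' A)

/-- The convex hull of `X` at scale `t`. -/
def scaleHull {E : Type*} [NormedAddCommGroup E] [NormedSpace ℝ E]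
    (X : Set E) (t : ℝ) : Set E :=
  ⋃ (σ : Set E) (_ : σ ⊆ X ∧ rad σ ≤ t), convexHull ℝ σ

/-- The convexity defect function `h_X(t)`. -/
noncomputable def cdf {E : Type*} [NormedAddCommGroup E] [NormedSpace ℝ E]
    (X : Set E) (t : ℝ) : ℝ :=
  asymmHaus (scaleHull X t) X

/-- The local convexity defect function `h^loc_X(p, r₁, r₂; t)`. -/
noncomputable def cdfLoc {E : Type*} [NormedAddCommGroup E] [NormedSpace ℝ E]
    (X : Set E) (p : E) (r₁ r₂ t : ℝ) : ℝ :=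
  asymmHaus
    (⋃ (σ : Set E) (_ : σ ⊆ X ∩ Metric.closedBall p r₁ ∧ rad σ ≤ t), convexHull ℝ σ)
    (X ∩ Metric.closedBall p r₂)

/-- The reach of a closed set `A`: the supremum of all `δ ≥ 0` such that every point at
distance `< δ` from `A` has a unique nearest point in `A`. -/
noncomputable def reach {E : Type*} [NormedAddCommGroup E] (A : Set E) : ℝ :=
  sSup {δ : ℝ | 0 ≤ δ ∧ ∀ y : E, Metric.infDist y A < δ →
    ∃! p : E, p ∈ A ∧ dist y p = Metric.infDist y A}

theorem rad_image_le_add {E : Type*} [NormedAddCommGroup E] {σ : Set E}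
    (hσ : Bornology.IsBounded σ) {ε : ℝ} (hε : 0 ≤ ε) {f : E → E}
    (hf : ∀ x ∈ σ, dist x (f x) ≤ ε) : rad (f '' σ) ≤ rad σ + ε := by
  refine le_of_forall_pos_le_add fun η hη => ?_
  have hne : {r : ℝ | 0 ≤ r ∧ ∃ c : E, σ ⊆ Metric.closedBall c r}.Nonempty := by
    obtain ⟨r, hr⟩ := hσ.subset_closedBall (0 : E)
    exact ⟨max r 0, le_max_right _ _, 0,
      hr.trans (Metric.closedBall_subset_closedBall (le_max_left _ _))⟩
  obtain ⟨r, ⟨hr0, c, hc⟩, hr⟩ := exists_lt_of_csInf_lt hne (lt_add_of_pos_right (rad σ) hη)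
  have hle : rad (f '' σ) ≤ r + ε := by
    refine csInf_le ⟨0, fun _ h => h.1⟩ ⟨by positivity, c, ?_⟩
    rintro _ ⟨x, hx, rfl⟩
    have h₁ : dist x c ≤ r := hc hx
    have h₂ := hf x hx
    have h₃ := dist_triangle_left (f x) c x
    simp only [Metric.mem_closedBall]
    linarith
  linarith

theorem infDist_le_cdf {E : Type*} [NormedAddCommGroup E] [NormedSpace ℝ E]
    {X : Set E} (hX : Bornology.IsBounded X) (hne : X.Nonempty) {t : ℝ} {x : E}
    (hx : x ∈ scaleHull X t) : Metric.infDist x X ≤ cdf X t := by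
  refine le_csSup ?_ ⟨x, hx, rfl⟩
  obtain ⟨p, hp⟩ := hne
  obtain ⟨r, hr⟩ := (isBounded_convexHull.mpr hX).subset_closedBall p
  refine ⟨r, ?_⟩
  rintro _ ⟨y, hy, rfl⟩
  obtain ⟨σ, ⟨hσ, -⟩, hyσ⟩ := Set.mem_iUnion₂.mp hy
  exact (Metric.infDist_le_dist_of_mem hp).trans (hr (convexHull_mono hσ hyσ))

theorem cdf_nonneg {E : Type*} [NormedAddCommGroup E] [NormedSpace ℝ E]
    (X : Set E) (t : ℝ) : 0 ≤ cdf X t := by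
  refine Real.sSup_nonneg ?_
  rintro _ ⟨y, -, rfl⟩
  exact Metric.infDist_nonneg

/-- Stability of the convexity defect function under Hausdorff perturbations. -/
theorem cdf_le_cdf_add {E : Type*} [NormedAddCommGroup E] [NormedSpace ℝ E]
    {A B : Set E} (hA : Bornology.IsBounded A) (hB : Bornology.IsBounded B)
    (hAne : A.Nonempty) (hBne : B.Nonempty) {ε : ℝ}
    (h : Metric.hausdorffDist A B < ε) (t : ℝ) :
    cdf A t ≤ cdf B (t + ε) + 2 * ε := by
  have hε : 0 < ε := Metric.hausdorffDist_nonneg.trans_lt h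
  have hfin := Metric.hausdorffEDist_ne_top_of_nonempty_of_bounded hAne hBne hA hB
  have hfin' := Metric.hausdorffEDist_ne_top_of_nonempty_of_bounded hBne hAne hB hA
  have hex : ∀ a, ∃ b, a ∈ A → b ∈ B ∧ dist a b < ε := fun a => by
    by_cases ha : a ∈ A
    · obtain ⟨b, hb, hab⟩ := Metric.exists_dist_lt_of_hausdorffDist_lt ha h hfin
      exact ⟨b, fun _ => ⟨hb, hab⟩⟩
    · exact ⟨a, fun h => absurd h ha⟩
  choose f hf using hex
  refine Real.sSup_le ?_ (by linarith [cdf_nonneg B (t + ε)])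
  rintro _ ⟨x, hx, rfl⟩
  obtain ⟨σ, ⟨hσA, hσt⟩, hxσ⟩ := Set.mem_iUnion₂.mp hx
  have hsub : convexHull ℝ σ ⊆
      Set.image2 (· + ·) (convexHull ℝ (f '' σ)) (Metric.closedBall 0 ε) := by
    refine convexHull_min (fun y hy => ?_) ?_
    · refine ⟨f y, subset_convexHull ℝ _ ⟨y, hy, rfl⟩, y - f y, ?_, by simp⟩
      simpa [dist_eq_norm] using (hf y (hσA hy)).2.le
    · exact (convex_convexHull ℝ _).add (convex_closedBall 0 ε)
  obtain ⟨y, hy, v, hv, rfl⟩ := hsub hxσ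
  have hyB : y ∈ scaleHull B (t + ε) := by
    refine Set.mem_iUnion₂.mpr ⟨f '' σ, ⟨?_, ?_⟩, hy⟩
    · rintro _ ⟨z, hz, rfl⟩
      exact (hf z (hσA hz)).1
    · have := rad_image_le_add (hA.subset hσA) hε.le fun z hz => (hf z (hσA hz)).2.le
      linarith
  have h₁ := infDist_le_cdf hB hBne hyB
  have h₂ : Metric.infDist y A ≤ Metric.infDist y B + Metric.hausdorffDist B A :=
    Metric.infDist_le_infDist_add_hausdorffDist hfin'
  have h₃ : Metric.infDist (y + v) A ≤ Metric.infDist y A + dist (y + v) y :=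
    Metric.infDist_le_infDist_add_dist
  have h₄ : dist (y + v) y ≤ ε := by simpa [dist_eq_norm] using hv
  rw [Metric.hausdorffDist_comm] at h₂
  show Metric.infDist (y + v) A ≤ _
  linarith

/-- Away from its endpoints the quarter-circle `s ↦ R - √(R² - s²)` lies below the diagonal
by more than `6 * ε`. -/
theorem sub_sqrt_lt_sub {R s ε : ℝ} (hε : 0 < ε) (hR : 100 * ε < R)
    (hs : 13 / 2 * ε ≤ s) (hsR : s < R - 9 / 4 * ε) :
    R - Real.sqrt (R ^ 2 - s ^ 2) < s - 6 * ε := by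
  have h : R - s + 6 * ε < Real.sqrt (R ^ 2 - s ^ 2) := by
    refine Real.lt_sqrt_of_sq_lt ?_
    nlinarith [mul_nonneg (sub_nonneg.mpr hs) (sub_nonneg.mpr hsR.le), mul_pos hε hε,
      mul_pos hε (sub_pos.mpr hR)]
  linarith

/-- approximating the weak feature size from a Hausdorff-close set, when the
reach equals the weak feature size and is separated from the local reach. -/
theorem wfs_approx (Rmin : ℝ) (hRmin : 0 < Rmin) :
    ∃ ε₀ > 0, ∀ ε : ℝ, 0 < ε → ε < min ε₀ (2 / 9 * Rmin) →
      ∀ (D : ℕ) (M Mt : Set (EuclideanSpace ℝ (Fin D))) (Rw RL : ℝ),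
        IsCompact M → M.Nonempty →
        Rmin ≤ Rw →
        9 / 4 * ε < RL - Rw →
        reach M = Rw →
        cdf M Rw = Rw →
        (∀ t : ℝ, 0 < t → t < Rw → cdf M t < t) →
        (∀ t : ℝ, 0 ≤ t → t < Rw → cdf M t ≤ RL - Real.sqrt (RL ^ 2 - t ^ 2)) →
        IsCompact Mt → Mt.Nonempty →
        Metric.hausdorffDist M Mt < ε →
        |Rw - sInf {t : ℝ | 22 / 4 * ε ≤ t ∧ t - 3 * ε ≤ cdf Mt t}| ≤ ε := by
  refine ⟨Rmin / 100, by positivity, ?_⟩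
  intro ε hε hlt D M Mt Rw RL hM hMne hRw hRL _ hfix _ hquarter hMt hMtne hH
  obtain ⟨hε₀, hε₁⟩ := lt_min_iff.mp hlt
  have hmem : Rw + ε ∈ {t : ℝ | 22 / 4 * ε ≤ t ∧ t - 3 * ε ≤ cdf Mt t} := by
    refine ⟨by linarith, ?_⟩
    have := cdf_le_cdf_add hM.isBounded hMt.isBounded hMne hMtne hH Rw
    linarith
  have hupper := csInf_le ⟨22 / 4 * ε, fun _ h => h.1⟩ hmem
  have hlower : Rw - ε ≤ sInf {t : ℝ | 22 / 4 * ε ≤ t ∧ t - 3 * ε ≤ cdf Mt t} := by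
    refine le_csInf ⟨_, hmem⟩ ?_
    rintro t ⟨ht, htc⟩
    by_contra! hlt
    have h₁ := cdf_le_cdf_add hMt.isBounded hM.isBounded hMtne hMne
      (Metric.hausdorffDist_comm.trans_lt hH) t
    have h₂ := hquarter (t + ε) (by linarith) (by linarith)
    have h₃ := sub_sqrt_lt_sub (R := RL) (s := t + ε) hε (by linarith) (by linarith)
      (by linarith)
    linarith
  rw [abs_le]
  constructor <;> linarith
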